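/- Let k ≤ n and let K = binom(n,k). Define the matrices A = (𝒲⁰(H·Z_I; Z_{σ_J}; H))_{I,J} and B = (𝒲^∞(Z_I; Z_{σ_J}; H))_{I,J}, indexed by k-element subsets of {1,...,n}. Then det A · det B = ∏_{I} (E(Z_I;H)·R(Z_{σ_I}))², i.e., with the normalized matrices A' = (A_{I,J}/(E(Z_I;H)R(Z_{σ_J})))_{I,J} and B' = (B_{I,J}/(E(Z_I;H)R(Z_{σ_J})))_{I,J}, one has B'·A' = Id_K and A'·B' = Id_K (as matrices over the field of rational functions ℂ(Z,H)). -/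

import Mathlib

noncomputable section

open MvPolynomial

/-- The rational-function field `ℂ(Z₁,…,Z_n,H)`. -/
abbrev ZF (n : ℕ) : Type := FractionRing (MvPolynomial (Fin n ⊕ Unit) ℂ)

def ZV (n : ℕ) (a : Fin n) : ZF n :=
  algebraMap (MvPolynomial (Fin n ⊕ Unit) ℂ) (ZF n) (X (Sum.inl a))

def HV (n : ℕ) : ZF n :=
  algebraMap (MvPolynomial (Fin n ⊕ Unit) ℂ) (ZF n) (X (Sum.inr ()))

/-- The function `U(T;Z;H)` of formula (3.1). -/
def Ufun {F : Type*} [Field F] (n k : ℕ) (T : Fin k → F) (Z : Fin n → F)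
    (H : F) : F :=
  ∏ i : Fin k,
    ((∏ a ∈ Finset.univ.filter (fun a : Fin n => a.1 < i.1),
        (1 - H * Z a / T i)) *
     (∏ b ∈ Finset.univ.filter (fun b : Fin n => i.1 < b.1 ∧ b.1 < k),
        (1 - Z b / T i)) *
     (∏ j ∈ Finset.univ.filter (fun j : Fin k => i < j),
        ((1 - H * T j / T i) / (1 - T j / T i))))

/-- The reduced trigonometric weight function `𝒲(T;Z;H) = Sym_T U(T;Z;H)`. -/
def Wtrig {F : Type*} [Field F] (n k : ℕ) (T : Fin k → F) (Z : Fin n → F)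
    (H : F) : F :=
  ∑ σ : Equiv.Perm (Fin k), Ufun n k (T ∘ σ) Z H

/-- The trigonometric weight function
`𝒲⁰(T;Z;H) = 𝒲(T;Z;H) ∏_{i≤k} ∏_{a>k} (1 − Z_a/T_i)`. -/
def W0 {F : Type*} [Field F] (n k : ℕ) (T : Fin k → F) (Z : Fin n → F)
    (H : F) : F :=
  Wtrig n k T Z H *
    ∏ i : Fin k, ∏ a ∈ Finset.univ.filter (fun a : Fin n => k ≤ a.1),
      (1 - Z a / T i)

/-- `E(T;H) = ∏_i ∏_{j≠i} (1 − H·T_i/T_j)`. -/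
def Efun {F : Type*} [Field F] (k : ℕ) (T : Fin k → F) (H : F) : F :=
  ∏ i : Fin k, ∏ j ∈ Finset.univ.filter (fun j : Fin k => j ≠ i),
    (1 - H * T i / T j)

/-- `R(Z) = ∏_{a≤k} ∏_{b>k} (1 − Z_b/Z_a)`. -/
def Rfun {F : Type*} [Field F] (n k : ℕ) (Z : Fin n → F) : F :=
  ∏ a ∈ Finset.univ.filter (fun a : Fin n => a.1 < k),
    ∏ b ∈ Finset.univ.filter (fun b : Fin n => k ≤ b.1),
      (1 - Z b / Z a)

/-- The increasing enumeration of a `k`-element subset of `{1, …, n}`. -/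
def enum {n k : ℕ} (I : Finset (Fin n)) (hI : I.card = k) : Fin k → Fin n :=
  fun a => (I.orderIsoOfFin hI a : Fin n)

/-- The minimal-length permutation `σ_J` with `{σ_J(1),…,σ_J(k)} = J`. -/
def permOfSubset {n k : ℕ} (hk : k ≤ n) (J : Finset (Fin n)) (hJ : J.card = k) :
    Equiv.Perm (Fin n) :=
  (finCongr (Nat.add_sub_cancel' hk)).symm.trans <|
    finSumFinEquiv.symm.trans <|
      (Equiv.sumCongr (J.orderIsoOfFin hJ).toEquiv
          ((Jᶜ.orderIsoOfFin (by simp [Finset.card_compl, hJ])).toEquiv.trans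
            (Equiv.subtypeEquivRight fun x => Finset.mem_compl))).trans
        (Equiv.sumCompl (· ∈ J))


/-- The opposite trigonometric weight function
`𝒲^∞(T;Z;H) = H^{k(k−1)/2} 𝒲(T;Z;H) ∏_{i≤k} ∏_{a>k} (1 − H·Z_a/T_i)`. -/
def Winf {F : Type*} [Field F] (n k : ℕ) (T : Fin k → F) (Z : Fin n → F)
    (H : F) : F :=
  H ^ (k * (k - 1) / 2) * Wtrig n k T Z H *
    ∏ i : Fin k, ∏ a ∈ Finset.univ.filter (fun a : Fin n => k ≤ a.1),
      (1 - H * Z a / T i)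


/-- The injective tuples of length `k` whose set of entries is `S`. -/
def orderings {α : Type*} [DecidableEq α] (k : ℕ) (S : Finset α) : Finset (Fin k → α) :=
  (Fintype.piFinset fun _ => S).filter fun y =>
    Function.Injective y ∧ Finset.univ.image y = S

lemma mem_orderings {α : Type*} [DecidableEq α] {k : ℕ} {S : Finset α} {y : Fin k → α} :
    y ∈ orderings k S ↔ Function.Injective y ∧ Finset.univ.image y = S := by
  simp only [orderings, Finset.mem_filter, Fintype.mem_piFinset, and_iff_right_iff_imp]
  rintro ⟨-, rfl⟩ i
  exact Finset.mem_image_of_mem _ (Finset.mem_univ _)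

lemma orderings_eq_empty {α : Type*} [DecidableEq α] {k : ℕ} {S : Finset α} (h : S.card ≠ k) :
    orderings k S = ∅ := by
  refine Finset.eq_empty_of_forall_notMem fun y hy => h ?_
  obtain ⟨hinj, rfl⟩ := mem_orderings.mp hy
  rw [Finset.card_image_of_injective _ hinj, Finset.card_fin]

lemma cons_mem_orderings {α : Type*} [DecidableEq α] {k : ℕ} {S : Finset α} {x : α}
    {y : Fin k → α} :
    (Fin.cons x y : Fin (k + 1) → α) ∈ orderings (k + 1) S ↔
      x ∈ S ∧ y ∈ orderings k (S.erase x) := by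
  have himg : Finset.univ.image (Fin.cons x y : Fin (k + 1) → α) =
      insert x (Finset.univ.image y) := by
    ext s
    simp [Fin.exists_fin_succ, eq_comm]
  simp only [mem_orderings, himg, Fin.cons_injective_iff]
  have hx : x ∉ Set.range y ↔ x ∉ Finset.univ.image y := by simp
  rw [hx]
  constructor
  · rintro ⟨⟨hx, hy⟩, rfl⟩
    exact ⟨Finset.mem_insert_self _ _, hy, (Finset.erase_insert hx).symm⟩
  · rintro ⟨hxS, hy, hS⟩
    rw [hS]
    exact ⟨⟨Finset.notMem_erase _ _, hy⟩, Finset.insert_erase hxS⟩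

section WeightSpace

variable {F : Type*} [Field F]

/-- The summand of the weight function, in the inverse variables `y = 1 / T`. -/
def wtTerm (H : F) {k : ℕ} (y z : Fin k → F) : F :=
  ∏ i, ((∏ a ∈ Finset.univ.filter (· < i), (1 - H * z a * y i)) *
    (∏ b ∈ Finset.univ.filter (i < ·), (1 - z b * y i)) *
    ∏ j ∈ Finset.univ.filter (i < ·), (y j - H * y i) / (y j - y i))

lemma wtTerm_cons (H : F) {k : ℕ} (x w : F) (y z : Fin k → F) :
    wtTerm H (Fin.cons x y : Fin (k + 1) → F) (Fin.cons w z) =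
      (∏ b, (1 - z b * x)) * (∏ j, (y j - H * x) / (y j - x)) * (∏ i, (1 - H * w * y i)) *
        wtTerm H y z := by
  simp only [wtTerm, Finset.prod_filter]
  simp only [Fin.prod_univ_succ, Fin.cons_zero, Fin.cons_succ, Fin.succ_lt_succ_iff,
    Fin.succ_pos, Fin.not_lt_zero, if_true, if_false, Finset.prod_mul_distrib, one_mul,
    lt_irrefl, Finset.prod_const_one]
  ring

variable [DecidableEq F]

/-- Multiplication of a function of a finite set of points by `∏ (1 - H z s)`. -/
def wtMul (H z : F) : (Finset F → F) →ₗ[F] (Finset F → F) where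
  toFun f S := (∏ s ∈ S, (1 - H * z * s)) * f S
  map_add' f g := by ext S; simp [mul_add]
  map_smul' c f := by ext S; simp [mul_left_comm]

/-- The shuffle product from the left with a one-variable weight function attached to `z`,
where `L` lists the parameters of the remaining letters. -/
def wtCons (H z : F) (L : List F) : (Finset F → F) →ₗ[F] (Finset F → F) where
  toFun f S := ∑ x ∈ S, (L.map fun b => 1 - b * x).prod *
    (∏ y ∈ S.erase x, (y - H * x) / (y - x) * (1 - H * z * y)) * f (S.erase x)
  map_add' f g := by ext S; simp [mul_add, Finset.sum_add_distrib]
  map_smul' c f := by ext S; simp [mul_left_comm, Finset.mul_sum]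

/-- The space of weight functions with parameters `L`, as functions of a finite set of points. -/
def wtSpace (H : F) : List F → Submodule F (Finset F → F)
  | [] => Submodule.span F {fun S => if S = ∅ then 1 else 0}
  | z :: L => (wtSpace H L).map (wtMul H z) ⊔ (wtSpace H L).map (wtCons H z L)

/-- The common form of the two mixed products of `wtMul` and `wtCons`. -/
def wtExch (H z w c : F) (L : List F) (f : Finset F → F) : Finset F → F := fun S =>
  ∑ x ∈ S, (1 - c * x) * ((L.map fun b => 1 - b * x).prod *
    (∏ y ∈ S.erase x, (y - H * x) / (y - x) * ((1 - H * z * y) * (1 - H * w * y))) *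
      f (S.erase x))

lemma wtExch_comm (H z w c : F) (L : List F) (f : Finset F → F) :
    wtExch H z w c L f = wtExch H w z c L f := by
  ext S
  simp only [wtExch, mul_comm (1 - H * z * _)]

lemma wtMul_wtCons (H z w : F) (L : List F) (f : Finset F → F) :
    wtMul H z (wtCons H w L f) = wtExch H z w (H * z) L f := by
  ext S
  simp only [wtMul, wtCons, wtExch, LinearMap.coe_mk, AddHom.coe_mk, Finset.mul_sum]
  refine Finset.sum_congr rfl fun x hx => ?_
  rw [← Finset.mul_prod_erase S _ hx]
  simp only [Finset.prod_mul_distrib]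
  ring

lemma wtCons_wtMul (H z w : F) (L : List F) (f : Finset F → F) :
    wtCons H z (w :: L) (wtMul H w f) = wtExch H z w w L f := by
  ext S
  simp only [wtMul, wtCons, wtExch, LinearMap.coe_mk, AddHom.coe_mk, List.map_cons,
    List.prod_cons]
  refine Finset.sum_congr rfl fun x hx => ?_
  simp only [Finset.prod_mul_distrib]
  ring

lemma wtExch_eq_smul_add (H z w c : F) (L : List F) (f : Finset F → F) (h : H * z ≠ w) :
    wtExch H z w c L f = ((c - w) / (H * z - w)) • wtExch H z w (H * z) L f +
      ((H * z - c) / (H * z - w)) • wtExch H z w w L f := by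
  ext S
  have h' : H * z - w ≠ 0 := sub_ne_zero.mpr h
  simp only [wtExch, Pi.add_apply, Pi.smul_apply, smul_eq_mul, Finset.mul_sum,
    ← Finset.sum_add_distrib]
  refine Finset.sum_congr rfl fun x _ => ?_
  have e : 1 - c * x = (c - w) / (H * z - w) * (1 - H * z * x) +
      (H * z - c) / (H * z - w) * (1 - w * x) := by
    field_simp
    ring
  rw [e]
  ring

lemma sum_erase_symm_eq (S : Finset F) (g h B : F → F → F)
    (hB : ∀ x y, B x y = B y x)
    (hgh : ∀ x y, x ≠ y → g x y + g y x = h x y + h y x) :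
    ∑ x ∈ S, ∑ y ∈ S.erase x, g x y * B x y = ∑ x ∈ S, ∑ y ∈ S.erase x, h x y * B x y := by
  rw [← sub_eq_zero, ← Finset.sum_sub_distrib]
  simp only [← Finset.sum_sub_distrib, ← sub_mul]
  rw [Finset.sum_sigma']
  refine Finset.sum_involution (fun p _ => ⟨p.2, p.1⟩) ?_ ?_ ?_ ?_
  · rintro ⟨x, y⟩ hp
    simp only [Finset.mem_sigma, Finset.mem_erase] at hp
    simp only
    rw [hB y x, ← add_mul]
    have := hgh x y hp.2.1.symm
    rw [show g x y - h x y + (g y x - h y x) = 0 by linear_combination this, zero_mul]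
  · rintro ⟨x, y⟩ hp - heq
    simp only [Finset.mem_sigma, Finset.mem_erase] at hp
    simp only [Sigma.mk.injEq, heq_eq_eq] at heq
    exact hp.2.1 heq.1
  · rintro ⟨x, y⟩ hp
    simp only [Finset.mem_sigma, Finset.mem_erase] at hp ⊢
    exact ⟨hp.2.2, hp.2.1.symm, hp.1⟩
  · intros; rfl

lemma wtCons_wtCons_comm (H z w : F) (L : List F) (f : Finset F → F) :
    wtCons H z (w :: L) (wtCons H w L f) = wtCons H w (z :: L) (wtCons H z L f) := by
  ext S
  have key : ∀ z w : F, wtCons H z (w :: L) (wtCons H w L f) S =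
      ∑ x ∈ S, ∑ y ∈ S.erase x,
        ((1 - w * x) * (1 - H * z * y) * ((y - H * x) / (y - x))) *
        ((L.map fun b => 1 - b * x).prod * (L.map fun b => 1 - b * y).prod *
          (∏ s ∈ (S.erase x).erase y, (s - H * x) / (s - x)) *
          (∏ s ∈ (S.erase x).erase y, (s - H * y) / (s - y)) *
          ((∏ s ∈ (S.erase x).erase y, (1 - H * z * s)) *
            ∏ s ∈ (S.erase x).erase y, (1 - H * w * s)) *
          f ((S.erase x).erase y)) := by
    intro z w
    simp only [wtCons, LinearMap.coe_mk, AddHom.coe_mk, List.map_cons, List.prod_cons,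
      Finset.mul_sum]
    refine Finset.sum_congr rfl fun x hx => Finset.sum_congr rfl fun y hy => ?_
    rw [← Finset.mul_prod_erase (S.erase x) _ hy]
    simp only [Finset.prod_mul_distrib]
    ring
  rw [key z w, key w z]
  simp only [mul_comm (∏ s ∈ _, (1 - H * w * s)) (∏ s ∈ _, (1 - H * z * s))]
  refine sum_erase_symm_eq S _ _ _ (fun x y => ?_) (fun x y hxy => ?_)
  · rw [Finset.erase_right_comm]
    ring
  · have h1 : y - x ≠ 0 := sub_ne_zero.mpr hxy.symm
    have h2 : x - y ≠ 0 := sub_ne_zero.mpr hxy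
    rw [show x - y = -(y - x) by ring]
    field_simp
    ring

lemma wtSpace_swap_le (H z w : F) (L : List F) (h : H * w ≠ z) :
    wtSpace H (z :: w :: L) ≤ wtSpace H (w :: z :: L) := by
  have hexch : ∀ c : F, ∀ f ∈ wtSpace H L, wtExch H z w c L f ∈ wtSpace H (w :: z :: L) := by
    intro c f hf
    rw [wtExch_comm, wtExch_eq_smul_add H w z c L f h, ← wtMul_wtCons, ← wtCons_wtMul]
    refine add_mem (Submodule.smul_mem _ _ ?_) (Submodule.smul_mem _ _ ?_)
    · exact Submodule.mem_sup_left (Submodule.mem_map_of_mem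
        (Submodule.mem_sup_right (Submodule.mem_map_of_mem hf)))
    · exact Submodule.mem_sup_right (Submodule.mem_map_of_mem
        (Submodule.mem_sup_left (Submodule.mem_map_of_mem hf)))
  rw [wtSpace, wtSpace, Submodule.map_sup, Submodule.map_sup]
  refine sup_le (sup_le ?_ ?_) (sup_le ?_ ?_)
  all_goals
    rintro _ ⟨_, ⟨f, hf, rfl⟩, rfl⟩
  · refine Submodule.mem_sup_left ⟨wtMul H z f,
      Submodule.mem_sup_left (Submodule.mem_map_of_mem hf), ?_⟩
    ext S
    simp only [wtMul, LinearMap.coe_mk, AddHom.coe_mk]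
    ring
  · rw [wtMul_wtCons]
    exact hexch _ f hf
  · rw [wtCons_wtMul]
    exact hexch _ f hf
  · rw [wtCons_wtCons_comm]
    exact Submodule.mem_sup_right (Submodule.mem_map_of_mem
        (Submodule.mem_sup_right (Submodule.mem_map_of_mem hf)))

lemma wtCons_perm (H z : F) {L M : List F} (h : L.Perm M) : wtCons H z L = wtCons H z M := by
  ext f S
  simp only [wtCons, LinearMap.coe_mk, AddHom.coe_mk, fun x : F =>
    (h.map fun b => 1 - b * x).prod_eq]

/-- The space of weight functions does not depend on the order of generic parameters. -/
lemma wtSpace_le_of_perm (H : F) {L M : List F} (h : L.Perm M)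
    (hL : ∀ a ∈ L, ∀ b ∈ L, H * a ≠ b) : wtSpace H L ≤ wtSpace H M := by
  induction h with
  | nil => exact le_rfl
  | cons z h ih =>
    rw [wtSpace, wtSpace, wtCons_perm H z h]
    have := ih fun a ha b hb => hL a (List.mem_cons_of_mem _ ha) b (List.mem_cons_of_mem _ hb)
    exact sup_le_sup (Submodule.map_mono this) (Submodule.map_mono this)
  | swap z w L => exact wtSpace_swap_le H w z L (hL z (by simp) w (by simp))
  | trans h₁ _ ih₁ ih₂ =>
    exact (ih₁ hL).trans (ih₂ fun a ha b hb => hL a (h₁.mem_iff.mpr ha) b (h₁.mem_iff.mpr hb))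

lemma finiteDimensional_wtSpace (H : F) (L : List F) : FiniteDimensional F (wtSpace H L) := by
  induction L with
  | nil => rw [wtSpace]; infer_instance
  | cons z L ih => rw [wtSpace]; infer_instance

lemma finrank_wtSpace_le (H : F) (L : List F) :
    Module.finrank F (wtSpace H L) ≤ 2 ^ L.length := by
  induction L with
  | nil =>
    rw [wtSpace]
    exact (finrank_span_le_card _).trans (by simp)
  | cons z L ih =>
    have := finiteDimensional_wtSpace H L
    rw [wtSpace, List.length_cons, pow_succ, mul_two]
    exact (Submodule.finrank_add_le_finrank_add_finrank _ _).trans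
      (add_le_add ((Submodule.finrank_map_le _ _).trans ih)
        ((Submodule.finrank_map_le _ _).trans ih))

lemma prod_of_mem_orderings {k : ℕ} {S : Finset F} {y : Fin k → F} (hy : y ∈ orderings k S)
    (g : F → F) : ∏ i, g (y i) = ∏ s ∈ S, g s := by
  obtain ⟨hinj, rfl⟩ := mem_orderings.mp hy
  rw [Finset.prod_image fun a _ b _ h => hinj h]

lemma sum_orderings_succ {k : ℕ} (S : Finset F) (φ : (Fin (k + 1) → F) → F) :
    ∑ y ∈ orderings (k + 1) S, φ y =
      ∑ x ∈ S, ∑ y ∈ orderings k (S.erase x), φ (Fin.cons x y) := by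
  rw [Finset.sum_sigma']
  refine Finset.sum_bij' (fun y _ => ⟨y 0, Fin.tail y⟩) (fun p _ => Fin.cons p.1 p.2)
    ?_ ?_ ?_ ?_ ?_
  · intro y hy
    rw [← Fin.cons_self_tail y, cons_mem_orderings] at hy
    simpa using hy
  · intro p hp
    rw [cons_mem_orderings]
    simpa using hp
  · intro y _
    exact Fin.cons_self_tail y
  · intro p _
    simp
  · intro y _
    simp

lemma sum_orderings_image {k : ℕ} {T : Fin k → F} (hT : Function.Injective T)
    (φ : (Fin k → F) → F) :
    ∑ y ∈ orderings k (Finset.univ.image T), φ y = ∑ σ : Equiv.Perm (Fin k), φ (T ∘ σ) := by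
  symm
  refine Finset.sum_bij (fun σ _ => T ∘ σ) ?_ ?_ ?_ (fun _ _ => rfl)
  · intro σ _
    rw [mem_orderings]
    refine ⟨hT.comp σ.injective, ?_⟩
    rw [← Finset.image_image, Finset.image_univ_equiv]
  · intro σ _ τ _ h
    ext i
    exact congrArg Fin.val (hT (congrFun h i))
  · intro y hy
    obtain ⟨hinj, himg⟩ := mem_orderings.mp hy
    have hex : ∀ i, ∃ j, T j = y i := fun i => by
      have : y i ∈ Finset.univ.image T := himg ▸ Finset.mem_image_of_mem _ (Finset.mem_univ i)
      simpa using this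
    choose s hs using hex
    have hs_inj : Function.Injective s := fun i j hij => hinj (by rw [← hs, ← hs, hij])
    exact ⟨Equiv.ofBijective s (Finite.injective_iff_bijective.mp hs_inj), Finset.mem_univ _,
      funext hs⟩

/-- The weight function in the inverse variables, as a function of their set. -/
def wtSym (H : F) {k : ℕ} (z : Fin k → F) (S : Finset F) : F :=
  ∑ y ∈ orderings k S, wtTerm H y z

lemma wtSym_eq_zero (H : F) {k : ℕ} (z : Fin k → F) {S : Finset F} (h : S.card ≠ k) :
    wtSym H z S = 0 := by
  rw [wtSym, orderings_eq_empty h, Finset.sum_empty]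

lemma indicator_empty_mem_wtSpace (H : F) (L : List F) :
    (fun S : Finset F => if S = ∅ then (1 : F) else 0) ∈ wtSpace H L := by
  induction L with
  | nil => exact Submodule.mem_span_singleton_self _
  | cons z L ih =>
    refine Submodule.mem_sup_left ⟨_, ih, ?_⟩
    ext S
    by_cases hS : S = ∅ <;> simp [wtMul, hS]

lemma wtSym_mul_mem_wtSpace (H : F) {k : ℕ} (z : Fin k → F) (L : List F) :
    (fun S => wtSym H z S * ∏ s ∈ S, (L.map fun b => 1 - b * s).prod) ∈
      wtSpace H (List.ofFn z ++ L) := by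
  induction k with
  | zero =>
    rw [List.ofFn_zero, List.nil_append]
    convert indicator_empty_mem_wtSpace H L using 2 with S
    by_cases hS : S = ∅
    · subst hS
      have : orderings 0 (∅ : Finset F) = {Fin.elim0} := by
        ext y
        simp only [mem_orderings, Finset.mem_singleton, Finset.univ_eq_empty,
          Finset.image_empty, and_true]
        exact ⟨fun _ => Subsingleton.elim _ _, fun _ => Function.injective_of_subsingleton _⟩
      simp [wtSym, wtTerm, this]
    · rw [wtSym_eq_zero H z (by simpa using hS)]
      simp [hS]
  | succ k ih =>
    rw [List.ofFn_succ, List.cons_append]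
    refine Submodule.mem_sup_right ⟨_, ih (fun i => z i.succ), ?_⟩
    ext S
    simp only [wtCons, LinearMap.coe_mk, AddHom.coe_mk, wtSym]
    rw [sum_orderings_succ, Finset.sum_mul]
    refine Finset.sum_congr rfl fun x hx => ?_
    rw [Finset.sum_mul, Finset.sum_mul, Finset.mul_sum]
    refine Finset.sum_congr rfl fun y hy => ?_
    have hz : z = Fin.cons (z 0) fun i => z i.succ := (Fin.cons_self_tail z).symm
    conv_rhs => rw [hz]
    rw [wtTerm_cons, prod_of_mem_orderings hy fun s => (s - H * x) / (s - x),
      prod_of_mem_orderings hy fun s => 1 - H * z 0 * s, ← Finset.mul_prod_erase S _ hx,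
      List.map_append, List.prod_append, List.map_ofFn, List.prod_ofFn, Finset.prod_mul_distrib]
    simp only [Function.comp_apply]
    ring

lemma prod_mul_mem_wtSpace (H : F) (L M : List F) {f : Finset F → F} (hf : f ∈ wtSpace H M) :
    (fun S => (∏ s ∈ S, (L.map fun b => 1 - H * b * s).prod) * f S) ∈ wtSpace H (L ++ M) := by
  induction L with
  | nil => simpa using hf
  | cons z L ih =>
    refine Submodule.mem_sup_left ⟨_, ih, ?_⟩
    ext S
    simp [wtMul, Finset.prod_mul_distrib, mul_assoc]

end WeightSpace

section Link

variable {F : Type*} [Field F]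

lemma prod_filter_lt_eq_prod_castLE {n k : ℕ} (hk : k ≤ n) (p : ℕ → Prop) [DecidablePred p]
    (g : Fin n → F) :
    ∏ a ∈ Finset.univ.filter (fun a : Fin n => p a.1 ∧ a.1 < k), g a =
      ∏ a ∈ Finset.univ.filter (fun a : Fin k => p a.1), g (Fin.castLE hk a) := by
  symm
  refine Finset.prod_bij (fun a _ => Fin.castLE hk a) ?_ ?_ ?_ (fun _ _ => rfl)
  · intro a ha
    simpa using ha
  · intro a _ b _ h
    simpa using h
  · intro b hb
    simp only [Finset.mem_filter, Finset.mem_univ, true_and] at hb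
    exact ⟨⟨b.1, hb.2⟩, by simpa using hb.1, rfl⟩

lemma Ufun_eq_prod_fin {n k : ℕ} (hk : k ≤ n) (T : Fin k → F) (Z : Fin n → F) (H : F) :
    Ufun n k T Z H = ∏ i : Fin k,
      ((∏ a ∈ Finset.univ.filter (· < i), (1 - H * Z (Fin.castLE hk a) / T i)) *
      (∏ b ∈ Finset.univ.filter (i < ·), (1 - Z (Fin.castLE hk b) / T i)) *
      ∏ j ∈ Finset.univ.filter (i < ·), (1 - H * T j / T i) / (1 - T j / T i)) := by
  rw [Ufun]
  refine Finset.prod_congr rfl fun i _ => ?_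
  congr 2
  · have h := prod_filter_lt_eq_prod_castLE hk (· < i.1) fun a => 1 - H * Z a / T i
    simp only [← Fin.lt_def] at h
    rw [← h]
    refine Finset.prod_congr (Finset.filter_congr fun a _ => ?_) fun _ _ => rfl
    have := i.2
    omega
  · exact prod_filter_lt_eq_prod_castLE hk (i.1 < ·) fun a => 1 - Z a / T i

lemma Ufun_eq_wtTerm {n k : ℕ} (hk : k ≤ n) (T : Fin k → F) (hT : ∀ i, T i ≠ 0)
    (Z : Fin n → F) (H : F) :
    Ufun n k T Z H = wtTerm H (fun i => (T i)⁻¹) fun i => Z (Fin.castLE hk i) := by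
  rw [Ufun_eq_prod_fin hk, wtTerm]
  refine Finset.prod_congr rfl fun i _ => ?_
  simp only [div_eq_mul_inv _ (T i)]
  congr 1
  refine Finset.prod_congr rfl fun j _ => ?_
  rw [← mul_div_mul_left (1 - H * T j * (T i)⁻¹) _ (inv_ne_zero (hT j))]
  congr 1 <;> field_simp [hT j]

/-- The parameters `Z_a` with `a > k`. -/
def tailList {α : Type*} {n : ℕ} (k : ℕ) (Z : Fin n → α) : List α :=
  (Finset.univ.filter fun a : Fin n => k ≤ a.1).toList.map Z

lemma ofFn_append_tailList_perm {α : Type*} {n k : ℕ} (hk : k ≤ n) (Z : Fin n → α)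
    (σ : Equiv.Perm (Fin n)) :
    (List.ofFn (fun i => Z (σ (Fin.castLE hk i))) ++ tailList k (Z ∘ σ)).Perm (List.ofFn Z) := by
  have h1 : (List.ofFn (Z ∘ σ)).Perm (List.ofFn Z) := Equiv.Perm.ofFn_comp_perm σ Z
  refine List.Perm.trans ?_ h1
  obtain ⟨m, rfl⟩ := Nat.exists_eq_add_of_le hk
  rw [show (fun i => Z (σ (Fin.castLE hk i))) = fun i : Fin k => (Z ∘ σ) (Fin.castAdd m i) from rfl]
  generalize Z ∘ σ = Y
  rw [List.ofFn_add]
  refine List.Perm.append_left _ ?_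
  rw [tailList, List.ofFn_eq_map, ← Function.comp_def Y, ← List.map_map]
  refine List.Perm.map _ ?_
  refine (List.perm_ext_iff_of_nodup (Finset.nodup_toList _)
    ((List.nodup_finRange m).map (Fin.natAdd_injective m k))).mpr fun a => ?_
  simp only [Finset.mem_toList, Finset.mem_filter, Finset.mem_univ, true_and, List.mem_map,
    List.mem_finRange]
  constructor
  · intro h
    exact ⟨⟨a.1 - k, by omega⟩, Fin.ext (by simp; omega)⟩
  · rintro ⟨b, rfl⟩
    simp

lemma prod_map_tailList {n : ℕ} (k : ℕ) (Z : Fin n → F) (g : F → F) :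
    ((tailList k Z).map g).prod =
      ∏ a ∈ Finset.univ.filter (fun a : Fin n => k ≤ a.1), g (Z a) := by
  rw [tailList, List.map_map, Finset.prod_map_toList]
  rfl

variable [DecidableEq F]

lemma Wtrig_eq_wtSym {n k : ℕ} (hk : k ≤ n) {T : Fin k → F} (hT : ∀ i, T i ≠ 0)
    (hinj : Function.Injective T) (Z : Fin n → F) (H : F) :
    Wtrig n k T Z H =
      wtSym H (fun i => Z (Fin.castLE hk i)) (Finset.univ.image fun i => (T i)⁻¹) := by
  rw [Wtrig, wtSym, sum_orderings_image fun a b h => hinj (inv_injective h)]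
  exact Finset.sum_congr rfl fun σ _ => Ufun_eq_wtTerm hk _ (fun i => hT _) Z H

/-- The function `𝒲⁰` in the inverse variables, as a function of their set. -/
def wtZero (H : F) {n k : ℕ} (hk : k ≤ n) (Z : Fin n → F) (S : Finset F) : F :=
  wtSym H (fun i => Z (Fin.castLE hk i)) S * ∏ s ∈ S, ((tailList k Z).map fun b => 1 - b * s).prod

/-- The function `𝒲^∞` in the inverse variables, as a function of their set. -/
def wtInf (H : F) {n k : ℕ} (hk : k ≤ n) (Z : Fin n → F) (S : Finset F) : F :=
  H ^ (k * (k - 1) / 2) * wtSym H (fun i => Z (Fin.castLE hk i)) S *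
    ∏ s ∈ S, ((tailList k Z).map fun b => 1 - H * b * s).prod

lemma W0_eq_wtZero {n k : ℕ} (hk : k ≤ n) {T : Fin k → F} (hT : ∀ i, T i ≠ 0)
    (hinj : Function.Injective T) (Z : Fin n → F) (H : F) :
    W0 n k T Z H = wtZero H hk Z (Finset.univ.image fun i => (T i)⁻¹) := by
  rw [W0, wtZero, Wtrig_eq_wtSym hk hT hinj,
    Finset.prod_image fun a _ b _ h => hinj (inv_injective h)]
  simp only [prod_map_tailList, div_eq_mul_inv]

lemma Winf_eq_wtInf {n k : ℕ} (hk : k ≤ n) {T : Fin k → F} (hT : ∀ i, T i ≠ 0)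
    (hinj : Function.Injective T) (Z : Fin n → F) (H : F) :
    Winf n k T Z H = wtInf H hk Z (Finset.univ.image fun i => (T i)⁻¹) := by
  rw [Winf, wtInf, Wtrig_eq_wtSym hk hT hinj,
    Finset.prod_image fun a _ b _ h => hinj (inv_injective h)]
  simp only [prod_map_tailList, div_eq_mul_inv]

lemma wtZero_mem_wtSpace {n k : ℕ} (hk : k ≤ n) (Z : Fin n → F) (H : F)
    (hZ : ∀ a b, H * Z a ≠ Z b) (σ : Equiv.Perm (Fin n)) :
    wtZero H hk (Z ∘ σ) ∈ wtSpace H (List.ofFn Z) := by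
  have hp := ofFn_append_tailList_perm hk Z σ
  refine wtSpace_le_of_perm H hp ?_ (wtSym_mul_mem_wtSpace H _ _)
  simp only [hp.mem_iff, List.mem_ofFn]
  rintro _ ⟨a, rfl⟩ _ ⟨b, rfl⟩
  exact hZ a b

lemma wtInf_mem_wtSpace {n k : ℕ} (hk : k ≤ n) (Z : Fin n → F) (H : F)
    (hZ : ∀ a b, H * Z a ≠ Z b) (σ : Equiv.Perm (Fin n)) :
    wtInf H hk (Z ∘ σ) ∈ wtSpace H (List.ofFn Z) := by
  have hp := List.perm_append_comm.trans (ofFn_append_tailList_perm hk Z σ)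
  have hmem := wtSym_mul_mem_wtSpace H (fun i => Z (σ (Fin.castLE hk i))) []
  rw [List.append_nil] at hmem
  have := Submodule.smul_mem _ (H ^ (k * (k - 1) / 2))
    (prod_mul_mem_wtSpace H (tailList k (Z ∘ σ)) _ hmem)
  refine wtSpace_le_of_perm H hp ?_ ?_
  · simp only [hp.mem_iff, List.mem_ofFn]
    rintro _ ⟨a, rfl⟩ _ ⟨b, rfl⟩
    exact hZ a b
  · convert this using 1
    ext S
    simp only [wtInf, Function.comp_apply, Pi.smul_apply, smul_eq_mul, List.map_nil, List.prod_nil,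
      Finset.prod_const_one]
    ring

end Link

section Evaluation

variable {F : Type*} [Field F]

lemma perm_exists_lt_apply {k : ℕ} {σ : Equiv.Perm (Fin k)} (h : σ ≠ 1) : ∃ i, i < σ i := by
  by_contra! hle
  refine h (Equiv.ext fun i => ?_)
  have hsum : ∑ i, (σ i).1 = ∑ i : Fin k, i.1 := Equiv.sum_comp σ fun i : Fin k => i.1
  have := (Finset.sum_eq_sum_iff_of_le fun i _ => Fin.le_def.mp (hle i)).mp hsum i
    (Finset.mem_univ i)
  exact Fin.ext this

lemma perm_exists_apply_lt {k : ℕ} {σ : Equiv.Perm (Fin k)} (h : σ ≠ 1) : ∃ i, σ i < i := by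
  obtain ⟨i, hi⟩ := perm_exists_lt_apply (inv_ne_one.mpr h)
  exact ⟨σ⁻¹ i, by simpa using hi⟩

lemma Efun_eq_prod_lt {k : ℕ} (T : Fin k → F) (H : F) :
    Efun k T H = ∏ i, ∏ j ∈ Finset.univ.filter (i < ·),
      (1 - H * T j / T i) * (1 - H * T i / T j) := by
  have hsplit : ∀ i : Fin k, ∏ j ∈ Finset.univ.filter (· ≠ i), (1 - H * T i / T j) =
      (∏ j ∈ Finset.univ.filter (i < ·), (1 - H * T i / T j)) *
        ∏ j ∈ Finset.univ.filter (· < i), (1 - H * T i / T j) := by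
    intro i
    rw [← Finset.prod_union (Finset.disjoint_filter.mpr fun j _ h h' => lt_asymm h h'),
      ← Finset.filter_or]
    exact Finset.prod_congr (Finset.filter_congr fun j _ => by
      rw [ne_comm]; exact lt_or_lt_iff_ne.symm) fun _ _ => rfl
  simp only [Efun, hsplit, Finset.prod_mul_distrib]
  rw [mul_comm]
  congr 1
  exact Finset.prod_comm' (by simp)

lemma Wtrig_self {n k : ℕ} (hk : k ≤ n) (Z : Fin n → F) (H : F) (hZ : ∀ a, Z a ≠ 0)
    (hinj : Function.Injective Z) :
    Wtrig n k (fun i => Z (Fin.castLE hk i)) Z H = Efun k (fun i => Z (Fin.castLE hk i)) H := by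
  rw [Wtrig, Finset.sum_eq_single 1]
  · rw [Ufun_eq_prod_fin hk, Efun_eq_prod_lt]
    simp only [Equiv.Perm.coe_one, Function.comp_id, Finset.prod_mul_distrib,
      Finset.prod_div_distrib]
    rw [Finset.prod_comm' (s' := fun j => Finset.univ.filter (j < ·)) (t' := Finset.univ)
      (by simp)]
    rw [mul_assoc, mul_div_cancel₀, mul_comm]
    refine Finset.prod_ne_zero_iff.mpr fun i _ => Finset.prod_ne_zero_iff.mpr fun j hj h => ?_
    rw [sub_eq_zero, eq_comm, div_eq_one_iff_eq (hZ _)] at h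
    have := Fin.castLE_injective hk (hinj h)
    simp [this] at hj
  · intro σ _ hσ
    obtain ⟨i, hi⟩ := perm_exists_lt_apply hσ
    rw [Ufun_eq_prod_fin hk]
    refine Finset.prod_eq_zero (Finset.mem_univ i) ?_
    rw [Finset.prod_eq_zero (i := σ i) (s := Finset.univ.filter (i < ·)) (by simpa using hi)
      (by simp [hZ])]
    simp
  · simp

lemma Wtrig_smul_self {n k : ℕ} (hk : k ≤ n) (Z : Fin n → F) (H : F) (hH : H ≠ 0)
    (hZ : ∀ a, Z a ≠ 0) (hinj : Function.Injective Z) :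
    H ^ (k * (k - 1) / 2) * Wtrig n k (fun i => H * Z (Fin.castLE hk i)) Z H =
      Efun k (fun i => Z (Fin.castLE hk i)) H := by
  rw [Wtrig, Finset.sum_eq_single 1]
  · have hpow : H ^ (k * (k - 1) / 2) =
        ∏ i : Fin k, ∏ _j ∈ Finset.univ.filter (· < i), H := by
      simp only [Finset.prod_const, Finset.prod_pow_eq_pow_sum, Finset.filter_gt_eq_Iio,
        Fin.card_Iio]
      rw [Fin.sum_univ_eq_sum_range fun i => i, Finset.sum_range_id]
    rw [Ufun_eq_prod_fin hk, Efun_eq_prod_lt, hpow]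
    simp only [Equiv.Perm.coe_one, Function.comp_id, Finset.prod_mul_distrib]
    rw [Finset.prod_comm' (s' := fun j => Finset.univ.filter (j < ·)) (t' := Finset.univ)
      (f := fun i a => 1 - H * Z (Fin.castLE hk a) / (H * Z (Fin.castLE hk i))) (by simp),
      Finset.prod_comm' (s' := fun j => Finset.univ.filter (j < ·)) (t' := Finset.univ)
      (f := fun i a => H) (by simp)]
    simp only [← Finset.prod_mul_distrib]
    refine Finset.prod_congr rfl fun i _ => Finset.prod_congr rfl fun j hj => ?_
    have h1 := hZ (Fin.castLE hk i)
    have h2 := hZ (Fin.castLE hk j)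
    have h3 : Z (Fin.castLE hk i) - Z (Fin.castLE hk j) ≠ 0 := by
      rw [sub_ne_zero]
      intro h
      have := Fin.castLE_injective hk (hinj h)
      simp [this] at hj
    rw [show 1 - H * Z (Fin.castLE hk j) / (H * Z (Fin.castLE hk i)) =
      (Z (Fin.castLE hk i) - Z (Fin.castLE hk j)) / Z (Fin.castLE hk i) by field_simp]
    field_simp
    ring
  · intro σ _ hσ
    obtain ⟨i, hi⟩ := perm_exists_apply_lt hσ
    rw [Ufun_eq_prod_fin hk]
    refine Finset.prod_eq_zero (Finset.mem_univ i) ?_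
    rw [Finset.prod_eq_zero (i := σ i) (s := Finset.univ.filter (· < i)) (by simpa using hi)
      (by simp [hZ, hH])]
    simp
  · simp

lemma prod_tail_eq_Rfun {n k : ℕ} (hk : k ≤ n) (Z : Fin n → F) :
    ∏ i : Fin k, ∏ a ∈ Finset.univ.filter (fun a : Fin n => k ≤ a.1),
      (1 - Z a / Z (Fin.castLE hk i)) = Rfun n k Z := by
  have := prod_filter_lt_eq_prod_castLE hk (fun _ => True) fun b =>
    ∏ a ∈ Finset.univ.filter (fun a : Fin n => k ≤ a.1), (1 - Z a / Z b)
  simp only [true_and, Finset.filter_true] at this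
  exact this.symm

lemma W0_self {n k : ℕ} (hk : k ≤ n) (Z : Fin n → F) (H : F) (hZ : ∀ a, Z a ≠ 0)
    (hinj : Function.Injective Z) :
    W0 n k (fun i => Z (Fin.castLE hk i)) Z H =
      Efun k (fun i => Z (Fin.castLE hk i)) H * Rfun n k Z := by
  rw [W0, Wtrig_self hk Z H hZ hinj, prod_tail_eq_Rfun]

lemma Winf_smul_self {n k : ℕ} (hk : k ≤ n) (Z : Fin n → F) (H : F) (hH : H ≠ 0)
    (hZ : ∀ a, Z a ≠ 0) (hinj : Function.Injective Z) :
    Winf n k (fun i => H * Z (Fin.castLE hk i)) Z H =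
      Efun k (fun i => Z (Fin.castLE hk i)) H * Rfun n k Z := by
  rw [Winf, Wtrig_smul_self hk Z H hH hZ hinj, ← prod_tail_eq_Rfun hk]
  simp only [mul_div_mul_left _ _ hH]

lemma W0_eq_zero {n k : ℕ} (T : Fin k → F) (Z : Fin n → F) (H : F) (i : Fin k) (a : Fin n)
    (ha : k ≤ a.1) (hT : T i ≠ 0) (h : Z a = T i) : W0 n k T Z H = 0 := by
  rw [W0, Finset.prod_eq_zero (Finset.mem_univ i), mul_zero]
  exact Finset.prod_eq_zero (i := a) (by simpa using ha) (by rw [h, div_self hT, sub_self])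

lemma Winf_eq_zero {n k : ℕ} (T : Fin k → F) (Z : Fin n → F) (H : F) (i : Fin k) (a : Fin n)
    (ha : k ≤ a.1) (hT : T i ≠ 0) (h : H * Z a = T i) : Winf n k T Z H = 0 := by
  rw [Winf, Finset.prod_eq_zero (Finset.mem_univ i), mul_zero]
  exact Finset.prod_eq_zero (i := a) (by simpa using ha) (by rw [h, div_self hT, sub_self])

end Evaluation

section Interpolation

lemma permOfSubset_castLE {n k : ℕ} (hk : k ≤ n) (J : Finset (Fin n)) (hJ : J.card = k)
    (i : Fin k) : permOfSubset hk J hJ (Fin.castLE hk i) = enum J hJ i := by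
  have h : finSumFinEquiv.symm ((finCongr (Nat.add_sub_cancel' hk)).symm (Fin.castLE hk i)) =
      (Sum.inl i : Fin k ⊕ Fin (n - k)) := by
    rw [Equiv.symm_apply_eq]
    rfl
  simp only [permOfSubset, Equiv.trans_apply, h]
  rfl

lemma enum_mem {n k : ℕ} (J : Finset (Fin n)) (hJ : J.card = k) (i : Fin k) : enum J hJ i ∈ J :=
  (J.orderIsoOfFin hJ i).2

lemma enum_injective {n k : ℕ} (J : Finset (Fin n)) (hJ : J.card = k) :
    Function.Injective (enum J hJ) :=
  Subtype.val_injective.comp (J.orderIsoOfFin hJ).injective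

lemma image_enum {n k : ℕ} (J : Finset (Fin n)) (hJ : J.card = k) :
    Finset.univ.image (enum J hJ) = J := by
  refine Finset.eq_of_subset_of_card_le ?_ ?_
  · intro a ha
    obtain ⟨i, -, rfl⟩ := Finset.mem_image.mp ha
    exact enum_mem J hJ i
  · rw [Finset.card_image_of_injective _ (enum_injective J hJ), Finset.card_fin, hJ]

lemma exists_permOfSubset_eq {n k : ℕ} (hk : k ≤ n) (J : Finset (Fin n)) (hJ : J.card = k)
    {a : Fin n} (ha : a ∉ J) : ∃ b : Fin n, k ≤ b.1 ∧ permOfSubset hk J hJ b = a := by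
  refine ⟨(permOfSubset hk J hJ).symm a, ?_, Equiv.apply_symm_apply _ _⟩
  by_contra! hlt
  refine ha ?_
  have : permOfSubset hk J hJ (Fin.castLE hk ⟨_, hlt⟩) = a := Equiv.apply_symm_apply _ _
  rw [← this, permOfSubset_castLE]
  exact enum_mem J hJ _

lemma exists_enum_eq_permOfSubset {n k : ℕ} (hk : k ≤ n) {I J : Finset (Fin n)} (hI : I.card = k)
    (hJ : J.card = k) (hIJ : I ≠ J) :
    ∃ (i : Fin k) (b : Fin n), k ≤ b.1 ∧ permOfSubset hk J hJ b = enum I hI i := by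
  obtain ⟨a, haI, haJ⟩ : ∃ a ∈ I, a ∉ J := by
    by_contra! h
    exact hIJ (Finset.eq_of_subset_of_card_le h (hJ.trans hI.symm).le)
  rw [← image_enum I hI, Finset.mem_image] at haI
  obtain ⟨i, -, rfl⟩ := haI
  obtain ⟨b, hb, hba⟩ := exists_permOfSubset_eq hk J hJ haJ
  exact ⟨i, b, hb, hba⟩

variable {F : Type*} [Field F] {n k : ℕ} {Z : Fin n → F} {H : F}

lemma W0_enum (hk : k ≤ n) (hZ : ∀ a, Z a ≠ 0) (hinj : Function.Injective Z)
    (I J : Finset (Fin n)) (hI : I.card = k) (hJ : J.card = k) :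
    W0 n k (fun a => Z (enum I hI a)) (Z ∘ permOfSubset hk J hJ) H =
      if I = J then Efun k (fun a => Z (enum J hJ a)) H * Rfun n k (Z ∘ permOfSubset hk J hJ)
      else 0 := by
  split_ifs with h
  · subst h
    have := W0_self hk (Z ∘ permOfSubset hk I hI) H (fun a => hZ _)
      (hinj.comp (Equiv.injective _))
    simpa only [Function.comp_apply, permOfSubset_castLE] using this
  · obtain ⟨i, b, hb, hib⟩ := exists_enum_eq_permOfSubset hk hI hJ h
    exact W0_eq_zero _ _ _ i b hb (hZ _) (congrArg Z hib)

lemma Winf_smul_enum (hk : k ≤ n) (hH : H ≠ 0) (hZ : ∀ a, Z a ≠ 0)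
    (hinj : Function.Injective Z) (I J : Finset (Fin n)) (hI : I.card = k) (hJ : J.card = k) :
    Winf n k (fun a => H * Z (enum I hI a)) (Z ∘ permOfSubset hk J hJ) H =
      if I = J then Efun k (fun a => Z (enum J hJ a)) H * Rfun n k (Z ∘ permOfSubset hk J hJ)
      else 0 := by
  split_ifs with h
  · subst h
    have := Winf_smul_self hk (Z ∘ permOfSubset hk I hI) H hH (fun a => hZ _)
      (hinj.comp (Equiv.injective _))
    simpa only [Function.comp_apply, permOfSubset_castLE] using this
  · obtain ⟨i, b, hb, hib⟩ := exists_enum_eq_permOfSubset hk hI hJ h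
    exact Winf_eq_zero _ _ _ i b hb (mul_ne_zero hH (hZ _))
      (congrArg (fun a => H * Z a) hib)

lemma Efun_ne_zero {T : Fin k → F} (hT : ∀ i, T i ≠ 0) (h : ∀ i j, H * T i ≠ T j) :
    Efun k T H ≠ 0 := by
  refine Finset.prod_ne_zero_iff.mpr fun i _ => Finset.prod_ne_zero_iff.mpr fun j _ h0 => ?_
  rw [sub_eq_zero, eq_comm, div_eq_one_iff_eq (hT j)] at h0
  exact h i j h0

lemma Rfun_ne_zero (hZ : ∀ a, Z a ≠ 0) (hinj : Function.Injective Z) : Rfun n k Z ≠ 0 := by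
  refine Finset.prod_ne_zero_iff.mpr fun a ha => Finset.prod_ne_zero_iff.mpr fun b hb h0 => ?_
  rw [sub_eq_zero, eq_comm, div_eq_one_iff_eq (hZ a)] at h0
  have := hinj h0
  subst this
  simp only [Finset.mem_filter, Finset.mem_univ, true_and] at ha hb
  omega

lemma Efun_mul_Rfun_ne_zero (hk : k ≤ n) (hZ : ∀ a, Z a ≠ 0) (hinj : Function.Injective Z)
    (hgen : ∀ a b, H * Z a ≠ Z b) (I J : Finset (Fin n)) (hI : I.card = k) (hJ : J.card = k) :
    Efun k (fun a => Z (enum I hI a)) H * Rfun n k (Z ∘ permOfSubset hk J hJ) ≠ 0 :=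
  mul_ne_zero (Efun_ne_zero (fun _ => hZ _) fun _ _ => hgen _ _)
    (Rfun_ne_zero (fun _ => hZ _) (hinj.comp (Equiv.injective _)))

variable [DecidableEq F]

lemma image_inv_enum (I : Finset (Fin n)) (hI : I.card = k) :
    (Finset.univ.image fun i => (Z (enum I hI i))⁻¹) = I.image fun a => (Z a)⁻¹ := by
  conv_rhs => rw [← image_enum I hI]
  rw [Finset.image_image]
  rfl

lemma wtZero_image (hk : k ≤ n) (hZ : ∀ a, Z a ≠ 0) (hinj : Function.Injective Z)
    (I J : Finset (Fin n)) (hJ : J.card = k) :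
    wtZero H hk (Z ∘ permOfSubset hk J hJ) (I.image fun a => (Z a)⁻¹) =
      if I = J then Efun k (fun a => Z (enum J hJ a)) H * Rfun n k (Z ∘ permOfSubset hk J hJ)
      else 0 := by
  by_cases hI : I.card = k
  · rw [← W0_enum hk hZ hinj I J hI hJ, ← image_inv_enum I hI, W0_eq_wtZero hk (fun _ => hZ _)
      (hinj.comp (enum_injective I hI))]
  · rw [if_neg fun h => hI (by rw [h, hJ]), wtZero, wtSym_eq_zero, zero_mul]
    rwa [Finset.card_image_of_injective _ fun a b h => hinj (inv_injective h)]

lemma eq_zero_of_mem_wtSpace (hZ : ∀ a, Z a ≠ 0) (hinj : Function.Injective Z)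
    (hgen : ∀ a b, H * Z a ≠ Z b) {f : Finset F → F} (hf : f ∈ wtSpace H (List.ofFn Z))
    (h : ∀ I : Finset (Fin n), f (I.image fun a => (Z a)⁻¹) = 0) : f = 0 := by
  let ev : wtSpace H (List.ofFn Z) →ₗ[F] (Finset (Fin n) → F) :=
    { toFun := fun g I => g.1 (I.image fun a => (Z a)⁻¹)
      map_add' := fun _ _ => rfl
      map_smul' := fun _ _ => rfl }
  have hcard : ∀ J : Finset (Fin n), J.card ≤ n := fun J => card_finset_fin_le J
  let N : Finset (Fin n) → F := fun J =>
    Efun J.card (fun a => Z (enum J rfl a)) H *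
      Rfun n J.card (Z ∘ permOfSubset (hcard J) J rfl)
  have hN : ∀ J, N J ≠ 0 := fun J => Efun_mul_Rfun_ne_zero (hcard J) hZ hinj hgen J J rfl rfl
  have hsurj : Function.Surjective ev := by
    intro g
    refine ⟨∑ J, (g J / N J) • ⟨wtZero H (hcard J) (Z ∘ permOfSubset (hcard J) J rfl),
      wtZero_mem_wtSpace (hcard J) Z H hgen _⟩, ?_⟩
    ext I
    rw [map_sum, Finset.sum_apply, Finset.sum_eq_single I]
    · change g I / N I * wtZero _ _ _ _ = _
      rw [wtZero_image (hcard I) hZ hinj, if_pos rfl]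
      exact div_mul_cancel₀ _ (hN I)
    · intro J _ hJ
      change g J / N J * wtZero _ _ _ _ = _
      rw [wtZero_image (hcard J) hZ hinj, if_neg hJ.symm, mul_zero]
    · simp
  have := finiteDimensional_wtSpace H (List.ofFn Z)
  have hrank : Module.finrank F (wtSpace H (List.ofFn Z)) =
      Module.finrank F (Finset (Fin n) → F) := by
    refine le_antisymm ?_ (LinearMap.finrank_le_finrank_of_surjective hsurj)
    refine (finrank_wtSpace_le H _).trans ?_
    simp
  have hker := (LinearMap.injective_iff_surjective_of_finrank_eq_finrank hrank).mpr hsurj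
  have : (⟨f, hf⟩ : wtSpace H (List.ofFn Z)) = 0 := hker (by
    rw [map_zero]
    exact funext h)
  exact congrArg Subtype.val this

/-- Expansion of `𝒲^∞` in the functions `𝒲⁰` by interpolation. -/
lemma wtInf_eq_sum_wtZero (hk : k ≤ n) (hZ : ∀ a, Z a ≠ 0) (hinj : Function.Injective Z)
    (hgen : ∀ a b, H * Z a ≠ Z b) (σ : Equiv.Perm (Fin n)) :
    wtInf H hk (Z ∘ σ) = ∑ K : {s : Finset (Fin n) // s.card = k},
      (wtInf H hk (Z ∘ σ) (K.1.image fun a => (Z a)⁻¹) /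
        (Efun k (fun a => Z (enum K.1 K.2 a)) H * Rfun n k (Z ∘ permOfSubset hk K.1 K.2))) •
      wtZero H hk (Z ∘ permOfSubset hk K.1 K.2) := by
  rw [← sub_eq_zero]
  refine eq_zero_of_mem_wtSpace hZ hinj hgen (sub_mem (wtInf_mem_wtSpace hk Z H hgen σ)
    (sum_mem fun K _ => Submodule.smul_mem _ _ (wtZero_mem_wtSpace hk Z H hgen _))) fun I => ?_
  rw [Pi.sub_apply, Finset.sum_apply, sub_eq_zero]
  simp only [Pi.smul_apply, smul_eq_mul, wtZero_image hk hZ hinj]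
  by_cases hI : I.card = k
  · rw [Finset.sum_eq_single ⟨I, hI⟩]
    · rw [if_pos rfl, div_mul_cancel₀]
      exact Efun_mul_Rfun_ne_zero hk hZ hinj hgen I I hI hI
    · intro K _ hK
      rw [if_neg fun h => hK (Subtype.ext h.symm), mul_zero]
    · simp
  · rw [Finset.sum_eq_zero fun K _ => by rw [if_neg fun h : I = K.1 => hI (h ▸ K.2), mul_zero],
      wtInf, wtSym_eq_zero, mul_zero, zero_mul]
    rwa [Finset.card_image_of_injective _ fun a b h => hinj (inv_injective h)]

lemma sum_W0_mul_Winf (hk : k ≤ n) (hH : H ≠ 0) (hZ : ∀ a, Z a ≠ 0)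
    (hinj : Function.Injective Z) (hgen : ∀ a b, H * Z a ≠ Z b)
    (I J : {s : Finset (Fin n) // s.card = k}) :
    ∑ K : {s : Finset (Fin n) // s.card = k},
      W0 n k (fun a => H * Z (enum I.1 I.2 a)) (Z ∘ permOfSubset hk K.1 K.2) H /
          (Efun k (fun a => Z (enum I.1 I.2 a)) H * Rfun n k (Z ∘ permOfSubset hk K.1 K.2)) *
        (Winf n k (fun a => Z (enum K.1 K.2 a)) (Z ∘ permOfSubset hk J.1 J.2) H /
          (Efun k (fun a => Z (enum K.1 K.2 a)) H * Rfun n k (Z ∘ permOfSubset hk J.1 J.2))) =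
      if I = J then 1 else 0 := by
  have hT : ∀ i, H * Z (enum I.1 I.2 i) ≠ 0 := fun i => mul_ne_zero hH (hZ _)
  have hTinj : Function.Injective fun i => H * Z (enum I.1 I.2 i) := fun a b h =>
    enum_injective I.1 I.2 (hinj (mul_left_cancel₀ hH h))
  have hexp := congrFun (wtInf_eq_sum_wtZero (Z := Z) (H := H) hk hZ hinj hgen
    (permOfSubset hk J.1 J.2)) (Finset.univ.image fun i => (H * Z (enum I.1 I.2 i))⁻¹)
  rw [← Winf_eq_wtInf hk hT hTinj, Winf_smul_enum hk hH hZ hinj, Finset.sum_apply] at hexp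
  calc
    _ = (∑ K : {s : Finset (Fin n) // s.card = k},
        (wtInf H hk (Z ∘ permOfSubset hk J.1 J.2) (K.1.image fun a => (Z a)⁻¹) /
          (Efun k (fun a => Z (enum K.1 K.2 a)) H * Rfun n k (Z ∘ permOfSubset hk K.1 K.2))) *
        wtZero H hk (Z ∘ permOfSubset hk K.1 K.2)
          (Finset.univ.image fun i => (H * Z (enum I.1 I.2 i))⁻¹)) /
        (Efun k (fun a => Z (enum I.1 I.2 a)) H * Rfun n k (Z ∘ permOfSubset hk J.1 J.2)) := by
      rw [Finset.sum_div]
      refine Finset.sum_congr rfl fun K _ => ?_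
      rw [W0_eq_wtZero hk hT hTinj, Winf_eq_wtInf hk (fun _ => hZ _)
        (hinj.comp (enum_injective K.1 K.2)), image_inv_enum]
      simp only [div_eq_mul_inv, mul_inv]
      ring
    _ = _ := by
      simp only [Pi.smul_apply, smul_eq_mul] at hexp
      rw [← hexp]
      by_cases h : I = J
      · subst h
        rw [if_pos rfl, if_pos rfl,
          div_self (Efun_mul_Rfun_ne_zero hk hZ hinj hgen _ _ _ _)]
      · rw [if_neg fun h' => h (Subtype.ext h'), if_neg h, zero_div]

end Interpolation

lemma HV_ne_zero (n : ℕ) : HV n ≠ 0 := by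
  simp [HV]

lemma ZV_ne_zero (n : ℕ) (a : Fin n) : ZV n a ≠ 0 := by
  simp [ZV]

lemma ZV_injective (n : ℕ) : Function.Injective (ZV n) := fun _ _ h =>
  Sum.inl_injective (X_injective (IsFractionRing.injective _ (ZF n) h))

lemma HV_mul_ZV_ne (n : ℕ) (a b : Fin n) : HV n * ZV n a ≠ ZV n b := by
  intro h
  rw [HV, ZV, ZV, ← map_mul] at h
  have := congrArg totalDegree (IsFractionRing.injective _ (ZF n) h)
  rw [totalDegree_mul_of_isDomain (X_ne_zero _) (X_ne_zero _)] at this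
  simp at this

lemma det_of_div_mul {ι F : Type*} [Fintype ι] [DecidableEq ι] [Field F] (A : ι → ι → F)
    (e r : ι → F) :
    (Matrix.of fun i j => A i j / (e i * r j)).det =
      (Matrix.of A).det / ∏ i, e i * r i := by
  have : (Matrix.of fun i j => A i j / (e i * r j)) =
      Matrix.diagonal (fun i => (e i)⁻¹) * Matrix.of A * Matrix.diagonal fun j => (r j)⁻¹ := by
    ext i j
    simp [Matrix.diagonal_mul, Matrix.mul_diagonal, div_eq_mul_inv]
    ring
  rw [this, Matrix.det_mul, Matrix.det_mul, Matrix.det_diagonal, Matrix.det_diagonal,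
    Finset.prod_mul_distrib, div_eq_mul_inv, mul_inv, Finset.prod_inv_distrib,
    Finset.prod_inv_distrib]
  ring

/-- Corollary 4.4 (orthogonality relations).  With
`A_{I,J} = 𝒲⁰(H·Z_I; Z_{σ_J}; H)` and `B_{I,J} = 𝒲^∞(Z_I; Z_{σ_J}; H)`,
indexed by the `k`-element subsets of `{1,…,n}`:
`det A · det B = ∏_I (E(Z_I;H) R(Z_{σ_I}))²`, i.e. the normalized matrices
`A'_{I,J} = A_{I,J}/(E(Z_I;H) R(Z_{σ_J}))`, `B'_{I,J} = B_{I,J}/(E(Z_I;H) R(Z_{σ_J}))`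
satisfy `B'·A' = Id` and `A'·B' = Id`. -/
theorem trig_weight_orthogonality (n k : ℕ) (hk : k ≤ n) :
    (Matrix.of fun I J : {s : Finset (Fin n) // s.card = k} =>
        W0 n k (fun a => HV n * ZV n (enum I.1 I.2 a))
          (ZV n ∘ permOfSubset hk J.1 J.2) (HV n)).det *
      (Matrix.of fun I J : {s : Finset (Fin n) // s.card = k} =>
        Winf n k (fun a => ZV n (enum I.1 I.2 a))
          (ZV n ∘ permOfSubset hk J.1 J.2) (HV n)).det
      = ∏ I : {s : Finset (Fin n) // s.card = k},
          (Efun k (fun a => ZV n (enum I.1 I.2 a)) (HV n) *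
            Rfun n k (ZV n ∘ permOfSubset hk I.1 I.2)) ^ 2 ∧
    (Matrix.of fun I J : {s : Finset (Fin n) // s.card = k} =>
        Winf n k (fun a => ZV n (enum I.1 I.2 a))
            (ZV n ∘ permOfSubset hk J.1 J.2) (HV n) /
          (Efun k (fun a => ZV n (enum I.1 I.2 a)) (HV n) *
            Rfun n k (ZV n ∘ permOfSubset hk J.1 J.2))) *
      (Matrix.of fun I J : {s : Finset (Fin n) // s.card = k} =>
        W0 n k (fun a => HV n * ZV n (enum I.1 I.2 a))
            (ZV n ∘ permOfSubset hk J.1 J.2) (HV n) /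
          (Efun k (fun a => ZV n (enum I.1 I.2 a)) (HV n) *
            Rfun n k (ZV n ∘ permOfSubset hk J.1 J.2)))
      = (1 : Matrix {s : Finset (Fin n) // s.card = k}
          {s : Finset (Fin n) // s.card = k} (ZF n)) ∧
    (Matrix.of fun I J : {s : Finset (Fin n) // s.card = k} =>
        W0 n k (fun a => HV n * ZV n (enum I.1 I.2 a))
            (ZV n ∘ permOfSubset hk J.1 J.2) (HV n) /
          (Efun k (fun a => ZV n (enum I.1 I.2 a)) (HV n) *
            Rfun n k (ZV n ∘ permOfSubset hk J.1 J.2))) *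
      (Matrix.of fun I J : {s : Finset (Fin n) // s.card = k} =>
        Winf n k (fun a => ZV n (enum I.1 I.2 a))
            (ZV n ∘ permOfSubset hk J.1 J.2) (HV n) /
          (Efun k (fun a => ZV n (enum I.1 I.2 a)) (HV n) *
            Rfun n k (ZV n ∘ permOfSubset hk J.1 J.2)))
      = (1 : Matrix {s : Finset (Fin n) // s.card = k}
          {s : Finset (Fin n) // s.card = k} (ZF n)) := by
  classical
  have hinv : (Matrix.of fun I J : {s : Finset (Fin n) // s.card = k} =>
        W0 n k (fun a => HV n * ZV n (enum I.1 I.2 a))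
            (ZV n ∘ permOfSubset hk J.1 J.2) (HV n) /
          (Efun k (fun a => ZV n (enum I.1 I.2 a)) (HV n) *
            Rfun n k (ZV n ∘ permOfSubset hk J.1 J.2))) *
      (Matrix.of fun I J : {s : Finset (Fin n) // s.card = k} =>
        Winf n k (fun a => ZV n (enum I.1 I.2 a))
            (ZV n ∘ permOfSubset hk J.1 J.2) (HV n) /
          (Efun k (fun a => ZV n (enum I.1 I.2 a)) (HV n) *
            Rfun n k (ZV n ∘ permOfSubset hk J.1 J.2)))
      = (1 : Matrix {s : Finset (Fin n) // s.card = k}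
          {s : Finset (Fin n) // s.card = k} (ZF n)) := by
    ext I J
    rw [Matrix.mul_apply, Matrix.one_apply]
    exact sum_W0_mul_Winf hk (HV_ne_zero n) (ZV_ne_zero n) (ZV_injective n) (HV_mul_ZV_ne n) I J
  refine ⟨?_, mul_eq_one_comm.mp hinv, hinv⟩
  have hdet := congrArg Matrix.det hinv
  rw [Matrix.det_mul, Matrix.det_one, det_of_div_mul, det_of_div_mul, div_mul_div_comm,
    ← Finset.prod_mul_distrib, div_eq_one_iff_eq] at hdet
  · simpa only [sq] using hdet
  · exact Finset.prod_ne_zero_iff.mpr fun I _ => mul_self_ne_zero.mpr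
      (Efun_mul_Rfun_ne_zero hk (ZV_ne_zero n) (ZV_injective n) (HV_mul_ZV_ne n) _ _ _ _)

end
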